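/- Let Ω ⊆ ℝ² be open and connected, let f : Ω × ℝ → ℝ be smooth, and let η : Ω → ℝ be smooth with ∂η/∂y ≠ 0 everywhere on Ω. Suppose that η_{xx}(x,y) + 2p·η_{xy}(x,y) + p²·η_{yy}(x,y) + η_y(x,y)·f(x,y,p) = 0 for all (x,y) ∈ Ω and all p ∈ ℝ. Then on Ω × ℝ the following identities hold: f_{ppp} = 0; η_{yy} = −(1/2)·η_y·f_{pp}; η_{xy} = −(1/2)·η_y·f_p + (1/2)·p·η_y·f_{pp}; η_{xx} = −η_y·f + p·η_y·f_p − (1/2)·p²·η_y·f_{pp}; and f_{xp} = −f_{pp}·f + 2·f_y + (1/2)·f_p² − p·f_{yp}. -/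

import Mathlib

/-- Partial derivative in the first variable `x` of a function of `(x, y, p)`. -/
noncomputable def pdx (g : ℝ → ℝ → ℝ → ℝ) : ℝ → ℝ → ℝ → ℝ :=
  fun x y p => deriv (fun t => g t y p) x

/-- Partial derivative in the second variable `y` of a function of `(x, y, p)`. -/
noncomputable def pdy (g : ℝ → ℝ → ℝ → ℝ) : ℝ → ℝ → ℝ → ℝ :=
  fun x y p => deriv (fun t => g x t p) y

/-- Partial derivative in the third variable `p` of a function of `(x, y, p)`. -/
noncomputable def pdp (g : ℝ → ℝ → ℝ → ℝ) : ℝ → ℝ → ℝ → ℝ :=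
  fun x y p => deriv (fun t => g x y t) p

/-- Partial derivative in `x` of a function of `(x, y)`. -/
noncomputable def edx (g : ℝ → ℝ → ℝ) : ℝ → ℝ → ℝ :=
  fun x y => deriv (fun t => g t y) x

/-- Partial derivative in `y` of a function of `(x, y)`. -/
noncomputable def edy (g : ℝ → ℝ → ℝ) : ℝ → ℝ → ℝ :=
  fun x y => deriv (fun t => g x t) y

theorem hasDerivAt_edx_of_differentiableAt {g : ℝ → ℝ → ℝ} {x y : ℝ}
    (hg : DifferentiableAt ℝ (fun w : ℝ × ℝ => g w.1 w.2) (x, y)) :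
    HasDerivAt (fun t => g t y) (fderiv ℝ (fun w : ℝ × ℝ => g w.1 w.2) (x, y) (1, 0)) x :=
  HasFDerivAt.comp_hasDerivAt (f := fun t : ℝ => (t, y)) x hg.hasFDerivAt
    ((hasDerivAt_id x).prodMk (hasDerivAt_const x y))

theorem hasDerivAt_edy_of_differentiableAt {g : ℝ → ℝ → ℝ} {x y : ℝ}
    (hg : DifferentiableAt ℝ (fun w : ℝ × ℝ => g w.1 w.2) (x, y)) :
    HasDerivAt (fun t => g x t) (fderiv ℝ (fun w : ℝ × ℝ => g w.1 w.2) (x, y) (0, 1)) y :=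
  HasFDerivAt.comp_hasDerivAt (f := fun t : ℝ => (x, t)) y hg.hasFDerivAt
    ((hasDerivAt_const y x).prodMk (hasDerivAt_id y))

section SmoothOnOpen

variable {Ω : Set (ℝ × ℝ)} {g : ℝ → ℝ → ℝ}

theorem differentiableAt_of_contDiffOn_open (hΩ : IsOpen Ω)
    (hg : ContDiffOn ℝ (⊤ : ℕ∞) (fun w : ℝ × ℝ => g w.1 w.2) Ω) {w : ℝ × ℝ} (hw : w ∈ Ω) :
    DifferentiableAt ℝ (fun w : ℝ × ℝ => g w.1 w.2) w :=
  (hg.contDiffAt (hΩ.mem_nhds hw)).differentiableAt (by simp)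

theorem edx_eq_fderiv (hΩ : IsOpen Ω)
    (hg : ContDiffOn ℝ (⊤ : ℕ∞) (fun w : ℝ × ℝ => g w.1 w.2) Ω) {w : ℝ × ℝ} (hw : w ∈ Ω) :
    edx g w.1 w.2 = fderiv ℝ (fun w : ℝ × ℝ => g w.1 w.2) w (1, 0) :=
  (hasDerivAt_edx_of_differentiableAt (differentiableAt_of_contDiffOn_open hΩ hg hw)).deriv

theorem edy_eq_fderiv (hΩ : IsOpen Ω)
    (hg : ContDiffOn ℝ (⊤ : ℕ∞) (fun w : ℝ × ℝ => g w.1 w.2) Ω) {w : ℝ × ℝ} (hw : w ∈ Ω) :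
    edy g w.1 w.2 = fderiv ℝ (fun w : ℝ × ℝ => g w.1 w.2) w (0, 1) :=
  (hasDerivAt_edy_of_differentiableAt (differentiableAt_of_contDiffOn_open hΩ hg hw)).deriv

theorem hasDerivAt_edx (hΩ : IsOpen Ω)
    (hg : ContDiffOn ℝ (⊤ : ℕ∞) (fun w : ℝ × ℝ => g w.1 w.2) Ω) {x y : ℝ} (hw : (x, y) ∈ Ω) :
    HasDerivAt (fun t => g t y) (edx g x y) x :=
  (hasDerivAt_edx_of_differentiableAt
    (differentiableAt_of_contDiffOn_open hΩ hg hw)).differentiableAt.hasDerivAt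

theorem hasDerivAt_edy (hΩ : IsOpen Ω)
    (hg : ContDiffOn ℝ (⊤ : ℕ∞) (fun w : ℝ × ℝ => g w.1 w.2) Ω) {x y : ℝ} (hw : (x, y) ∈ Ω) :
    HasDerivAt (fun t => g x t) (edy g x y) y :=
  (hasDerivAt_edy_of_differentiableAt
    (differentiableAt_of_contDiffOn_open hΩ hg hw)).differentiableAt.hasDerivAt

theorem contDiffOn_edx (hΩ : IsOpen Ω)
    (hg : ContDiffOn ℝ (⊤ : ℕ∞) (fun w : ℝ × ℝ => g w.1 w.2) Ω) :
    ContDiffOn ℝ (⊤ : ℕ∞) (fun w : ℝ × ℝ => edx g w.1 w.2) Ω :=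
  ((hg.fderiv_of_isOpen hΩ (m := (⊤ : ℕ∞)) (by simp)).clm_apply contDiffOn_const).congr
    fun _ hw => edx_eq_fderiv hΩ hg hw

theorem contDiffOn_edy (hΩ : IsOpen Ω)
    (hg : ContDiffOn ℝ (⊤ : ℕ∞) (fun w : ℝ × ℝ => g w.1 w.2) Ω) :
    ContDiffOn ℝ (⊤ : ℕ∞) (fun w : ℝ × ℝ => edy g w.1 w.2) Ω :=
  ((hg.fderiv_of_isOpen hΩ (m := (⊤ : ℕ∞)) (by simp)).clm_apply contDiffOn_const).congr
    fun _ hw => edy_eq_fderiv hΩ hg hw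

theorem edx_edy_comm (hΩ : IsOpen Ω)
    (hg : ContDiffOn ℝ (⊤ : ℕ∞) (fun w : ℝ × ℝ => g w.1 w.2) Ω) {w : ℝ × ℝ} (hw : w ∈ Ω) :
    edx (edy g) w.1 w.2 = edy (edx g) w.1 w.2 := by
  have hnhds := hΩ.mem_nhds hw
  have hd : DifferentiableAt ℝ (fderiv ℝ fun w : ℝ × ℝ => g w.1 w.2) w :=
    ((hg.fderiv_of_isOpen hΩ (m := (⊤ : ℕ∞)) (by simp)).contDiffAt hnhds).differentiableAt
      (by simp)
  have hy : (fun w : ℝ × ℝ => edy g w.1 w.2) =ᶠ[nhds w]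
      fun w => fderiv ℝ (fun w : ℝ × ℝ => g w.1 w.2) w (0, 1) := by
    filter_upwards [hnhds] with v hv using edy_eq_fderiv hΩ hg hv
  have hx : (fun w : ℝ × ℝ => edx g w.1 w.2) =ᶠ[nhds w]
      fun w => fderiv ℝ (fun w : ℝ × ℝ => g w.1 w.2) w (1, 0) := by
    filter_upwards [hnhds] with v hv using edx_eq_fderiv hΩ hg hv
  rw [edx_eq_fderiv hΩ (contDiffOn_edy hΩ hg) hw, edy_eq_fderiv hΩ (contDiffOn_edx hΩ hg) hw,
    hy.fderiv_eq, hx.fderiv_eq, fderiv_clm_apply hd (differentiableAt_const _),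
    fderiv_clm_apply hd (differentiableAt_const _)]
  have hsymm := (hg.contDiffAt hnhds).isSymmSndFDerivAt (by
    rw [minSmoothness_of_isRCLikeNormedField]
    exact WithTop.coe_le_coe.2 (le_top : (2 : ℕ∞) ≤ ⊤))
  simpa using hsymm.eq (1, 0) (0, 1)

theorem edx_congr_of_isOpen (hΩ : IsOpen Ω) {h : ℝ → ℝ → ℝ}
    (hgh : ∀ w ∈ Ω, g w.1 w.2 = h w.1 w.2) {x y : ℝ} (hw : (x, y) ∈ Ω) :
    edx g x y = edx h x y := by
  have hc : Continuous fun t : ℝ => (t, y) := by fun_prop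
  refine Filter.EventuallyEq.deriv_eq ?_
  filter_upwards [(hΩ.preimage hc).mem_nhds hw] with t ht using hgh (t, y) ht

end SmoothOnOpen

theorem hasDerivAt_quadratic (a b c p : ℝ) :
    HasDerivAt (fun t => a + 2 * t * b + t ^ 2 * c) (2 * b + 2 * p * c) p := by
  refine ((((hasDerivAt_id p).const_mul 2).mul_const b |>.const_add a).add
    (((hasDerivAt_id p).pow 2).mul_const c)).congr_deriv ?_
  simp

theorem pdp_eq_of_quadratic {g : ℝ → ℝ → ℝ → ℝ} {x y a b c : ℝ}
    (hg : ∀ q, g x y q = a + 2 * q * b + q ^ 2 * c) (p : ℝ) :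
    pdp g x y p = 2 * b + 2 * p * c := by
  rw [pdp, funext hg]
  exact (hasDerivAt_quadratic a b c p).deriv

theorem hasDerivAt_neg_quadratic_div {a b c u : ℝ → ℝ} {a' b' c' u' x : ℝ} (p : ℝ)
    (ha : HasDerivAt a a' x) (hb : HasDerivAt b b' x) (hc : HasDerivAt c c' x)
    (hu : HasDerivAt u u' x) (hx : u x ≠ 0) :
    HasDerivAt (fun t => -((a t + 2 * p * b t + p ^ 2 * c t) / u t))
      ((-(a' / u x) + a x * u' / u x ^ 2) + 2 * p * (-(b' / u x) + b x * u' / u x ^ 2)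
        + p ^ 2 * (-(c' / u x) + c x * u' / u x ^ 2)) x := by
  refine (((ha.add (hb.const_mul (2 * p))).add (hc.const_mul (p ^ 2))).div hu hx).neg.congr_deriv ?_
  simp only [Pi.add_apply]
  field_simp
  ring

/-- If a smooth `η` on `Ω` with `η_y ≠ 0` satisfies
`η_xx + 2p·η_xy + p²·η_yy + η_y·f = 0` on `Ω × ℝ`, then the characteristic set
obtained by eliminating `η` holds: `f_ppp = 0`, the second derivatives of `η` are
expressed through `f`, and `f_xp = -f_pp·f + 2·f_y + (1/2)·f_p² - p·f_yp`. -/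
theorem statement2
    (Ω : Set (ℝ × ℝ)) (hΩo : IsOpen Ω) (hΩc : IsConnected Ω)
    (f : ℝ → ℝ → ℝ → ℝ)
    (hf : ContDiffOn ℝ (⊤ : ℕ∞) (fun z : ℝ × ℝ × ℝ => f z.1 z.2.1 z.2.2)
      {z : ℝ × ℝ × ℝ | (z.1, z.2.1) ∈ Ω})
    (η : ℝ → ℝ → ℝ)
    (hη : ContDiffOn ℝ (⊤ : ℕ∞) (fun w : ℝ × ℝ => η w.1 w.2) Ω)
    (hηy : ∀ w ∈ Ω, edy η w.1 w.2 ≠ 0)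
    (hpde : ∀ w ∈ Ω, ∀ p : ℝ,
      edx (edx η) w.1 w.2 + 2 * p * edx (edy η) w.1 w.2
        + p ^ 2 * edy (edy η) w.1 w.2 + edy η w.1 w.2 * f w.1 w.2 p = 0) :
    ∀ w ∈ Ω, ∀ p : ℝ,
      pdp (pdp (pdp f)) w.1 w.2 p = 0 ∧
      edy (edy η) w.1 w.2 = -(1 / 2) * edy η w.1 w.2 * pdp (pdp f) w.1 w.2 p ∧
      edx (edy η) w.1 w.2 =
        -(1 / 2) * edy η w.1 w.2 * pdp f w.1 w.2 p
          + (1 / 2) * p * edy η w.1 w.2 * pdp (pdp f) w.1 w.2 p ∧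
      edx (edx η) w.1 w.2 =
        - edy η w.1 w.2 * f w.1 w.2 p + p * edy η w.1 w.2 * pdp f w.1 w.2 p
          - (1 / 2) * p ^ 2 * edy η w.1 w.2 * pdp (pdp f) w.1 w.2 p ∧
      pdp (pdx f) w.1 w.2 p =
        - pdp (pdp f) w.1 w.2 p * f w.1 w.2 p + 2 * pdy f w.1 w.2 p
          + (1 / 2) * (pdp f w.1 w.2 p) ^ 2 - p * pdp (pdy f) w.1 w.2 p := by
  have hy := contDiffOn_edy hΩo hη
  have hx := contDiffOn_edx hΩo hη
  have hxx := contDiffOn_edx hΩo hx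
  have hxy := contDiffOn_edx hΩo hy
  have hyy := contDiffOn_edy hΩo hy
  have hfeq : ∀ w ∈ Ω, ∀ p : ℝ, f w.1 w.2 p =
      -((edx (edx η) w.1 w.2 + 2 * p * edx (edy η) w.1 w.2
        + p ^ 2 * edy (edy η) w.1 w.2) / edy η w.1 w.2) := by
    intro w hw p
    have := hηy w hw
    field_simp
    linear_combination hpde w hw p
  rintro ⟨x, y⟩ hw p
  have hu : edy η x y ≠ 0 := hηy _ hw
  have hf₀ : ∀ q, f x y q = -(edx (edx η) x y / edy η x y)
      + 2 * q * (-(edx (edy η) x y / edy η x y)) + q ^ 2 * (-(edy (edy η) x y / edy η x y)) := by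
    intro q
    rw [hfeq _ hw q]
    ring
  have hp : ∀ q, pdp f x y q = 2 * (-(edx (edy η) x y / edy η x y))
      + 2 * q * (-(edy (edy η) x y / edy η x y)) :=
    pdp_eq_of_quadratic hf₀
  have hpp : ∀ q, pdp (pdp f) x y q = 2 * (-(edy (edy η) x y / edy η x y)) := by
    intro q
    rw [pdp, funext hp]
    simp
  have hppp : pdp (pdp (pdp f)) x y p = 0 := by
    rw [pdp, funext hpp]
    simp
  have hfx := fun q => (hasDerivAt_neg_quadratic_div q (hasDerivAt_edx hΩo hxx hw)
    (hasDerivAt_edx hΩo hxy hw) (hasDerivAt_edx hΩo hyy hw) (hasDerivAt_edx hΩo hy hw) hu)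
  have hfy := fun q => (hasDerivAt_neg_quadratic_div q (hasDerivAt_edy hΩo hxx hw)
    (hasDerivAt_edy hΩo hxy hw) (hasDerivAt_edy hΩo hyy hw) (hasDerivAt_edy hΩo hy hw) hu)
  have hpdx := fun q => (show pdx f x y q = _ from ((hfx q).congr_of_eventuallyEq (by
    have hc : Continuous fun t : ℝ => (t, y) := by fun_prop
    filter_upwards [(hΩo.preimage hc).mem_nhds hw] with t ht using hfeq (t, y) ht q)).deriv)
  have hpdy := fun q => (show pdy f x y q = _ from ((hfy q).congr_of_eventuallyEq (by
    have hc : Continuous fun t : ℝ => (x, t) := by fun_prop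
    filter_upwards [(hΩo.preimage hc).mem_nhds hw] with t ht using hfeq (x, t) ht q)).deriv)
  have hpx := pdp_eq_of_quadratic hpdx p
  have hpy := pdp_eq_of_quadratic hpdy p
  have hxxy : edy (edx (edx η)) x y = edx (edx (edy η)) x y :=
    (edx_edy_comm hΩo hx hw).symm.trans
      (edx_congr_of_isOpen hΩo (fun v hv => (edx_edy_comm hΩo hη hv).symm) hw)
  have hxyy : edy (edx (edy η)) x y = edx (edy (edy η)) x y :=
    (edx_edy_comm hΩo hy hw).symm
  refine ⟨hppp, ?_, ?_, ?_, ?_⟩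
  · simp only [hpp]
    field_simp
  · simp only [hp, hpp]
    field_simp
    ring
  · simp only [hf₀, hp, hpp]
    field_simp
    ring
  · simp only [hf₀, hp, hpp, hpx, hpy, hpdy, hxxy, hxyy]
    field_simp
    ring
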